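/- (Theorem 1: description of the term clone of L.) For every k ≥ 1, a function h : (Fin k → ZMod 12) → ZMod 12 belongs to Clo_k(L) if and only if there exist coefficients a : Fin k → ZMod 12 and a function w ∈ W_k such that h x = (∑ i, a i * x i) + w x for all x. Moreover this representation is unique: the coefficients a and the function w are uniquely determined by h. -/

import Mathlib

/-- The natural projection `ZMod 12 → ZMod 4`. -/
def pi4 : ZMod 12 →+* ZMod 4 := ZMod.castHom (show (4:ℕ) ∣ 12 by norm_num) (ZMod 4)

/-- The cocycle `t` of Vaughan–Lee's loop. -/
def t (x y : ZMod 12) : ZMod 12 :=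
  if (pi4 x = 1 ∧ pi4 y = 3) ∨ (pi4 x = 3 ∧ pi4 y = 1) then 4 else 0

/-- The multiplication of Vaughan–Lee's loop `L`. -/
def mulL (x y : ZMod 12) : ZMod 12 := x + y + t x y

/-- `InClo k h` means `h` is a `k`-ary term function of `L`:
`h` lies in the closure of the projections under the pointwise loop operation. -/
inductive InClo (k : ℕ) : ((Fin k → ZMod 12) → ZMod 12) → Prop
  | proj (i : Fin k) : InClo k (fun x => x i)
  | mul {g h : (Fin k → ZMod 12) → ZMod 12} :
      InClo k g → InClo k h → InClo k (fun x => mulL (g x) (h x))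

/-- `Wset k` is the set of functions `w : (ZMod 12)^k → ZMod 12` taking values in
`C = {0,4,8}`, vanishing on tuples of even elements, invariant under negation, and
invariant under translation by tuples from `C` (i.e. factoring through `(ZMod 4)^k`). -/
def Wset (k : ℕ) : Set ((Fin k → ZMod 12) → ZMod 12) :=
  { w |
    (∀ x, w x ∈ ({0, 4, 8} : Set (ZMod 12))) ∧
    (∀ x, (∀ i, Even (x i)) → w x = 0) ∧
    (∀ x, w (-x) = w x) ∧
    (∀ x c, (∀ i, c i ∈ ({0, 4, 8} : Set (ZMod 12))) → w (x + c) = w x) }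

theorem t_mem (x y : ZMod 12) : t x y ∈ ({0, 4, 8} : Set (ZMod 12)) := by
  unfold t; split_ifs <;> simp

theorem t_neg_neg (x y : ZMod 12) : t (-x) (-y) = t x y := by
  revert x y; decide +kernel

theorem t_congr {x y x' y' : ZMod 12} (hx : pi4 x = pi4 x') (hy : pi4 y = pi4 y') :
    t x y = t x' y' := by
  simp only [t, hx, hy]

theorem t_of_even {x y : ZMod 12} (hx : Even x) : t x y = 0 := by
  obtain ⟨z, rfl⟩ := hx
  revert y z; decide +kernel

theorem add_mem_C {x y : ZMod 12} (hx : x ∈ ({0, 4, 8} : Set (ZMod 12)))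
    (hy : y ∈ ({0, 4, 8} : Set (ZMod 12))) : x + y ∈ ({0, 4, 8} : Set (ZMod 12)) := by
  simp only [Set.mem_insert_iff, Set.mem_singleton_iff] at *
  revert x y; decide +kernel

theorem mem_C_iff (x : ZMod 12) : x ∈ ({0, 4, 8} : Set (ZMod 12)) ↔ pi4 x = 0 := by
  simp only [Set.mem_insert_iff, Set.mem_singleton_iff]
  revert x; decide +kernel

theorem pi4_lift (a : ZMod 4) : pi4 (a.val : ZMod 12) = a := by simp

/-! ### Closure properties of the clone -/

namespace InClo

variable {k : ℕ} {f g : (Fin k → ZMod 12) → ZMod 12}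

theorem of_eq (hf : InClo k f) (h : ∀ x, g x = f x) : InClo k g := by
  rwa [funext h]

theorem two_mul (hf : InClo k f) : InClo k (fun x => 2 * f x) :=
  (hf.mul hf).of_eq fun x => by
    generalize f x = a; revert a; decide +kernel

theorem three_mul (hf : InClo k f) : InClo k (fun x => 3 * f x) :=
  (hf.two_mul.mul hf).of_eq fun x => by
    generalize f x = a; revert a; decide +kernel

theorem neg (hf : InClo k f) : InClo k (fun x => -f x) :=
  (hf.two_mul.two_mul.two_mul.mul hf.three_mul).of_eq fun x => by
    generalize f x = a; revert a; decide +kernel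

/-- The cocycle of two term functions is a term function. -/
theorem cocycle (hf : InClo k f) (hg : InClo k g) : InClo k (fun x => t (f x) (g x)) := by
  have hm := hf.mul hg
  have hodd := hm.mul hm.neg
  refine ((hm.mul (hf.neg.mul hg.neg)).mul hodd.two_mul).two_mul.of_eq fun x => ?_
  generalize f x = a
  generalize g x = b
  revert a b; decide +kernel

theorem add (hf : InClo k f) (hg : InClo k g) : InClo k (fun x => f x + g x) :=
  ((hf.mul hg).mul (hf.cocycle hg).two_mul).of_eq fun x => by
    generalize f x = a
    generalize g x = b
    revert a b; decide +kernel

theorem zero (hk : 1 ≤ k) : InClo k (fun _ => 0) :=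
  ((proj ⟨0, hk⟩).add (proj ⟨0, hk⟩).neg).of_eq fun x => by simp

theorem const_mul (hf : InClo k f) (c : ZMod 12) : InClo k (fun x => c * f x) := by
  have key (n : ℕ) : InClo k (fun x => n * f x) := by
    induction n with
    | zero => exact (hf.add hf.neg).of_eq fun x => by simp
    | succ n ih => exact (ih.add hf).of_eq fun x => by push_cast; ring
  exact (key c.val).of_eq fun x => by simp

theorem sum (hk : 1 ≤ k) {ι : Type*} (s : Finset ι) {F : ι → (Fin k → ZMod 12) → ZMod 12}
    (hF : ∀ i ∈ s, InClo k (F i)) : InClo k (fun x => ∑ i ∈ s, F i x) := by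
  classical
  induction s using Finset.induction_on with
  | empty => exact (zero hk).of_eq fun x => by simp
  | insert a s ha ih =>
    refine ((hF a (by simp)).add (ih fun i hi => hF i (by simp [hi]))).of_eq fun x => ?_
    rw [Finset.sum_insert ha]

/-- Over `ZMod 3`, the indicator of `0` in `(ZMod 4)²` is a combination of indicators of kernels
of linear forms. -/
theorem indicator_zero_eq_sum (v w : ZMod 12) :
    (if pi4 v = 0 ∧ pi4 w = 0 then (4 : ZMod 12) else 0) =
      ∑ m : Fin 4 × Fin 4, (if Even m.1.val ∧ Even m.2.val then 1 else 2) *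
        (if pi4 ((m.1.val : ZMod 12) * v + (m.2.val : ZMod 12) * w) = 0 then 4 else 0) := by
  revert v w; decide +kernel

theorem indicator_ker (hk : 1 ≤ k) (hf : InClo k f)
    (vs : List ((Fin k → ZMod 12) → ZMod 12)) (hvs : ∀ v ∈ vs, InClo k v) :
    InClo k (fun x =>
      if (pi4 (f x) = 1 ∨ pi4 (f x) = 3) ∧ ∀ v ∈ vs, pi4 (v x) = 0 then 4 else 0) := by
  match vs with
  | [] =>
    refine (hf.cocycle hf.neg).of_eq fun x => ?_
    simp only [List.not_mem_nil, false_implies, implies_true, and_true]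
    generalize f x = a
    revert a; decide +kernel
  | [v] =>
    refine (hf.cocycle (hf.add (hvs v (by simp))).neg).of_eq fun x => ?_
    simp only [List.mem_singleton, forall_eq]
    generalize f x = a
    generalize v x = b
    revert a b; decide +kernel
  | v :: w :: vs =>
    have ih (m : Fin 4 × Fin 4) := indicator_ker hk hf
      ((fun x => (m.1.val : ZMod 12) * v x + (m.2.val : ZMod 12) * w x) :: vs) (by
        simp only [List.mem_cons, forall_eq_or_imp] at hvs ⊢
        exact ⟨(hvs.1.const_mul _).add (hvs.2.1.const_mul _), hvs.2.2⟩)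
    refine (sum hk Finset.univ fun m _ =>
      (ih m).const_mul (if Even m.1.val ∧ Even m.2.val then 1 else 2)).of_eq fun x => ?_
    simp only [List.mem_cons, forall_eq_or_imp]
    by_cases h : (pi4 (f x) = 1 ∨ pi4 (f x) = 3) ∧ ∀ u ∈ vs, pi4 (u x) = 0
    · refine Eq.trans (if_congr (by tauto) rfl rfl) ((indicator_zero_eq_sum (v x) (w x)).trans
        (Finset.sum_congr rfl fun m _ => congrArg _ (if_congr (by tauto) rfl rfl)))
    · rw [if_neg (by tauto), Finset.sum_eq_zero]
      intro m _
      rw [if_neg (c := _ ∧ _ ∧ _) (by tauto), mul_zero]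
termination_by vs.length

/-- The indicator of the orbit `{p, -p}` modulo `4` is a term function if `p` is not even. -/
theorem indicator_orbit (hk : 1 ≤ k) (p : Fin k → ZMod 4) (j : Fin k) (hj : p j = 1 ∨ p j = 3) :
    InClo k (fun x =>
      if (p = fun i => pi4 (x i)) ∨ p = -fun i => pi4 (x i) then 4 else 0) := by
  refine (indicator_ker hk (proj j)
    (List.ofFn fun i x => x i + (-((p i * p j).val : ZMod 12)) * x j) ?_).of_eq fun x => ?_
  · intro v hv
    obtain ⟨i, rfl⟩ := (List.mem_ofFn' _ _).1 hv
    exact (proj i).add ((proj j).const_mul _)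
  · refine if_congr ?_ rfl rfl
    simp only [List.forall_mem_ofFn_iff, map_add, map_mul, map_neg, pi4_lift,
      funext_iff, Pi.neg_apply]
    constructor
    · rintro (h | h)
      · simp only [← h]
        refine ⟨hj, fun i => ?_⟩
        generalize p i = a, p j = b at *
        revert a b; decide
      · have h' (i) : pi4 (x i) = -p i := by rw [h, neg_neg]
        simp only [h']
        refine ⟨by generalize p j = b at *; revert b; decide, fun i => ?_⟩
        generalize p i = a, p j = b at *
        revert a b; decide
    · rintro ⟨hx, h⟩
      have h' (i) : pi4 (x i) = p i * p j * pi4 (x j) := by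
        rw [← sub_eq_zero, ← h i]; ring
      have hs : p j * pi4 (x j) = 1 ∨ p j * pi4 (x j) = -1 := by
        clear h h'
        generalize p j = b, pi4 (x j) = c at *
        revert b c; decide
      refine hs.imp (fun hs i => ?_) fun hs i => ?_ <;> rw [h' i, mul_assoc, hs] <;> simp

end InClo

/-! ### The functions in `Wset` -/

section

variable {k : ℕ} {w w' : (Fin k → ZMod 12) → ZMod 12}

theorem Wset_congr (hw : w ∈ Wset k) {x y : Fin k → ZMod 12} (h : ∀ i, pi4 (x i) = pi4 (y i)) :
    w x = w y := by
  have := hw.2.2.2 y (x - y) fun i => by rw [mem_C_iff]; simp [h]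
  rwa [add_sub_cancel] at this

theorem Wset_add (hw : w ∈ Wset k) (hw' : w' ∈ Wset k) : (fun x => w x + w' x) ∈ Wset k :=
  ⟨fun x => add_mem_C (hw.1 x) (hw'.1 x),
    fun x hx => by simp [hw.2.1 x hx, hw'.2.1 x hx],
    fun x => by simp [hw.2.2.1 x, hw'.2.2.1 x],
    fun x c hc => by simp [hw.2.2.2 x c hc, hw'.2.2.2 x c hc]⟩

theorem InClo_of_mem_Wset (hk : 1 ≤ k) (hw : w ∈ Wset k) : InClo k w := by
  classical
  have even_iff (a : ZMod 12) : Even a ↔ ¬ (pi4 a = 1 ∨ pi4 a = 3) := by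
    revert a; unfold Even; decide +kernel
  have hterm (p : Fin k → ZMod 4) : InClo k (fun x => w (fun i => ((p i).val : ZMod 12)) *
      if (p = fun i => pi4 (x i)) ∨ p = -fun i => pi4 (x i) then 4 else 0) := by
    by_cases h : ∃ j, p j = 1 ∨ p j = 3
    · obtain ⟨j, hj⟩ := h
      exact (InClo.indicator_orbit hk p j hj).const_mul _
    · refine (InClo.zero hk).of_eq fun x => ?_
      rw [hw.2.1, zero_mul]
      intro i
      rw [even_iff, pi4_lift]
      exact fun hi => h ⟨i, hi⟩
  refine (InClo.sum hk Finset.univ fun p _ => hterm p).two_mul.of_eq fun x => ?_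
  set q : Fin k → ZMod 4 := fun i => pi4 (x i) with hq
  have hq1 : w (fun i => ((q i).val : ZMod 12)) = w x :=
    Wset_congr hw fun i => pi4_lift _
  have hq2 : w (fun i => (((-q) i).val : ZMod 12)) = w x := by
    rw [← hw.2.2.1 x]
    exact Wset_congr hw fun i => by rw [pi4_lift, Pi.neg_apply, Pi.neg_apply, map_neg]
  by_cases hx : ∀ i, Even (x i)
  · rw [hw.2.1 x hx, Finset.sum_eq_zero, mul_zero]
    intro p _
    split_ifs with h
    · rcases h with rfl | rfl
      · rw [hq1, hw.2.1 x hx, zero_mul]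
      · rw [hq2, hw.2.1 x hx, zero_mul]
    · exact mul_zero _
  · push Not at hx
    obtain ⟨j, hj⟩ := hx
    have hne : q ≠ -q := by
      intro h
      have := congrFun h j
      rw [even_iff, not_not] at hj
      simp only [hq, Pi.neg_apply] at this
      generalize pi4 (x j) = a at *
      revert a; decide
    have hsum : ∑ p, w (fun i => ((p i).val : ZMod 12)) * (if p = q ∨ p = -q then 4 else 0) =
        w x * 4 + w x * 4 := by
      simp only [mul_ite, mul_zero]
      rw [← Finset.sum_filter,
        show Finset.univ.filter (fun p => p = q ∨ p = -q) = {q, -q} by ext; simp,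
        Finset.sum_pair hne, hq1, hq2]
    rw [hsum]
    have := (mem_C_iff _).1 (hw.1 x)
    clear hsum hq1 hq2
    generalize w x = a at *
    revert a; decide +kernel

theorem pi4_linear_add (hw : w ∈ Wset k) (a x : Fin k → ZMod 12) :
    pi4 ((∑ i, a i * x i) + w x) = ∑ i, pi4 (a i) * pi4 (x i) := by
  rw [map_add, (mem_C_iff _).1 (hw.1 x), add_zero, map_sum]
  simp only [map_mul]

theorem exists_rep_of_InClo {h : (Fin k → ZMod 12) → ZMod 12} (hh : InClo k h) :
    ∃ (a : Fin k → ZMod 12) (w : (Fin k → ZMod 12) → ZMod 12),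
      w ∈ Wset k ∧ ∀ x, h x = (∑ i, a i * x i) + w x := by
  induction hh with
  | proj i => exact ⟨Pi.single i 1, 0, by simp [Wset], fun x => by simp [Pi.single_apply]⟩
  | @mul f g hf hg ihf ihg =>
    obtain ⟨a, u, hu, hfa⟩ := ihf
    obtain ⟨b, v, hv, hgb⟩ := ihg
    refine ⟨a + b, fun x => u x + v x + t (f x) (g x), Wset_add (Wset_add hu hv)
      ⟨fun x => t_mem _ _, fun x hx => t_of_even ?_, fun x => ?_, fun x c hc => ?_⟩, fun x => ?_⟩
    · rw [hfa, hu.2.1 x hx, add_zero]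
      exact Finset.even_sum _ fun i _ => (hx i).mul_left _
    · beta_reduce
      rw [← t_neg_neg (f x)]
      refine t_congr ?_ ?_ <;> rw [map_neg] <;>
        simp only [hfa, hgb, pi4_linear_add hu, pi4_linear_add hv] <;> simp
    · have hc' (i) : pi4 (c i) = 0 := (mem_C_iff _).1 (hc i)
      have hxc (i) : pi4 ((x + c) i) = pi4 (x i) := by rw [Pi.add_apply, map_add, hc', add_zero]
      refine t_congr ?_ ?_ <;> simp only [hfa, hgb, pi4_linear_add hu, pi4_linear_add hv, hxc]
    · simp only [mulL, Pi.add_apply, add_mul, Finset.sum_add_distrib]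
      nth_rewrite 1 [hfa, hgb]
      ring

theorem rep_unique {a a' : Fin k → ZMod 12} (hw : w ∈ Wset k) (hw' : w' ∈ Wset k)
    (h : ∀ x, (∑ i, a i * x i) + w x = (∑ i, a' i * x i) + w' x) : a = a' ∧ w = w' := by
  have ha : a = a' := by
    funext i
    have h1 := congrArg pi4 (h (Pi.single i 1))
    have h2 := h (Pi.single i 2)
    have he : ∀ j, Even ((Pi.single i 2 : Fin k → ZMod 12) j) := by
      intro j
      rcases eq_or_ne j i with rfl | hj
      · simp
      · simp [hj]
    rw [hw.2.1 _ he, hw'.2.1 _ he] at h2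
    rw [pi4_linear_add hw, pi4_linear_add hw'] at h1
    simp only [← map_mul, ← map_sum] at h1
    simp only [Pi.single_apply, mul_ite, mul_zero, mul_one, Finset.sum_ite_eq', Finset.mem_univ,
      if_true, add_zero] at h1 h2
    generalize a i = b, a' i = b' at *
    revert b b'; decide +kernel
  subst ha
  exact ⟨rfl, funext fun x => add_left_cancel (h x)⟩

end

theorem stmt_13 (k : ℕ) (hk : 1 ≤ k) (h : (Fin k → ZMod 12) → ZMod 12) :
    (InClo k h ↔
      ∃ (a : Fin k → ZMod 12) (w : (Fin k → ZMod 12) → ZMod 12),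
        w ∈ Wset k ∧ ∀ x, h x = (∑ i, a i * x i) + w x) ∧
    (∀ (a a' : Fin k → ZMod 12) (w w' : (Fin k → ZMod 12) → ZMod 12),
      w ∈ Wset k → w' ∈ Wset k →
      (∀ x, h x = (∑ i, a i * x i) + w x) →
      (∀ x, h x = (∑ i, a' i * x i) + w' x) →
      a = a' ∧ w = w') := by
  refine ⟨⟨exists_rep_of_InClo, ?_⟩, fun a a' w w' hw hw' ha ha' =>
    rep_unique hw hw' fun x => (ha x).symm.trans (ha' x)⟩
  rintro ⟨a, w, hw, hh⟩
  exact ((InClo.sum hk Finset.univ fun i _ => (InClo.proj i).const_mul (a i)).add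
    (InClo_of_mem_Wset hk hw)).of_eq hh
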